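/- arXiv:1012.2809 — 3 statements merged into one kernel-verified Lean document; each statement's English description precedes it below -/
import Mathlib

section
/- Let V be a finite-dimensional real vector space, S ⊆ V a nonempty convex subset, and K a subgroup of GL(V) whose closure in GL(V) is compact, such that k(S) ⊆ S for every k ∈ K. If S is open or S is closed, then S contains a point fixed by every element of K (namely, the average v₀ = ∫_{K̄} k·v dμ(k) of any v ∈ S with respect to the normalized Haar measure μ on the closure K̄ of K lies in S and is K-fixed). -/
/-- The Haar average of the orbit map of a compact group is a fixed point in any closed convex set
containing the orbit. -/
theorem Subgroup.exists_fixed_mem_of_isCompact_of_orbit_subset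
    {V : Type*} [NormedAddCommGroup V] [NormedSpace ℝ V] [CompleteSpace V]
    (G : Subgroup (V →L[ℝ] V)ˣ) (hG : IsCompact (G : Set (V →L[ℝ] V)ˣ))
    {C : Set V} (hC_conv : Convex ℝ C) (hC_closed : IsClosed C) (v : V)
    (hv : ∀ g ∈ G, (g : V →L[ℝ] V) v ∈ C) :
    ∃ v₀ ∈ C, ∀ g ∈ G, (g : V →L[ℝ] V) v₀ = v₀ := by
  have : CompactSpace G := isCompact_iff_compactSpace.mp hG
  borelize ↥G
  let μ : MeasureTheory.Measure G := MeasureTheory.Measure.haarMeasure ⊤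
  have : MeasureTheory.IsProbabilityMeasure μ := ⟨MeasureTheory.Measure.haarMeasure_self⟩
  have hcont : Continuous fun g : G => ((g : (V →L[ℝ] V)ˣ) : V →L[ℝ] V) v :=
    (ContinuousLinearMap.apply ℝ V v).continuous.comp
      (Units.continuous_val.comp continuous_subtype_val)
  have hint : MeasureTheory.Integrable (fun g : G => ((g : (V →L[ℝ] V)ˣ) : V →L[ℝ] V) v) μ :=
    hcont.integrable_of_hasCompactSupport (HasCompactSupport.of_compactSpace _)
  refine ⟨∫ g : G, ((g : (V →L[ℝ] V)ˣ) : V →L[ℝ] V) v ∂μ,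
    hC_conv.integral_mem hC_closed (.of_forall fun g => hv g g.2) hint, fun k hk => ?_⟩
  rw [← ContinuousLinearMap.integral_comp_comm _ hint]
  exact MeasureTheory.integral_mul_left_eq_self (μ := μ)
    (fun g : G => ((g : (V →L[ℝ] V)ˣ) : V →L[ℝ] V) v) ⟨k, hk⟩

/-- If a set that is closed, or open and convex, is invariant under a set of invertible operators,
then it is invariant under the closure of that set of operators. -/
theorem Convex.apply_mem_of_mem_closure_units
    {V : Type*} [NormedAddCommGroup V] [NormedSpace ℝ V]
    {S : Set V} (hS_conv : Convex ℝ S) (hS : IsOpen S ∨ IsClosed S) {K : Set (V →L[ℝ] V)ˣ}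
    (hKS : ∀ k ∈ K, ∀ x ∈ S, (k : V →L[ℝ] V) x ∈ S)
    {g : (V →L[ℝ] V)ˣ} (hg : g ∈ closure K) {x : V} (hx : x ∈ S) :
    (g : V →L[ℝ] V) x ∈ S := by
  have hcl : (g : V →L[ℝ] V) '' S ⊆ closure S := by
    rintro _ ⟨y, hy, rfl⟩
    exact map_mem_closure (f := fun k : (V →L[ℝ] V)ˣ => (k : V →L[ℝ] V) y)
      ((ContinuousLinearMap.apply ℝ V y).continuous.comp Units.continuous_val) hg
      fun k hk => hKS k hk y hy
  rcases hS with hS | hS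
  · have himage : IsOpen ((g : V →L[ℝ] V) '' S) :=
      (ContinuousLinearEquiv.unitsEquiv ℝ V g).toHomeomorph.isOpenMap S hS
    have hmem : (g : V →L[ℝ] V) x ∈ interior (closure S) :=
      interior_maximal hcl himage (Set.mem_image_of_mem _ hx)
    rwa [hS_conv.interior_closure_eq_interior_of_nonempty_interior
      (by rw [hS.interior_eq]; exact ⟨x, hx⟩), hS.interior_eq] at hmem
  · simpa only [hS.closure_eq] using hcl (Set.mem_image_of_mem _ hx)

/-- A compact subset of an open convex set has its closed convex hull in that set. -/
theorem IsCompact.closure_convexHull_subset_of_isOpen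
    {E : Type*} [SeminormedAddCommGroup E] [NormedSpace ℝ E] {A S : Set E}
    (hA : IsCompact A) (hS : IsOpen S) (hS_conv : Convex ℝ S) (hAS : A ⊆ S) :
    closure (convexHull ℝ A) ⊆ S := by
  obtain ⟨δ, hδ, hsub⟩ := hA.exists_thickening_subset_open hS hAS
  refine (Metric.closure_subset_thickening hδ _).trans ?_
  rw [← add_ball_zero, ← (convex_ball (0 : E) δ).convexHull_eq, ← convexHull_add, add_ball_zero]
  exact convexHull_min hsub hS_conv

/-- **Fixed points of compact groups acting on convex sets.**
Let `V` be a finite-dimensional real vector space, `S ⊆ V` a nonempty convex subset,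
and `K` a subgroup of `GL(V)` whose closure in `GL(V)` is compact and which leaves
`S` invariant.  If `S` is open or closed, then `S` contains a `K`-fixed point. -/
theorem convex_set_invariant_under_relatively_compact_group_has_fixed_point
    {V : Type*} [NormedAddCommGroup V] [NormedSpace ℝ V] [FiniteDimensional ℝ V]
    (S : Set V) (hS_ne : S.Nonempty) (hS_conv : Convex ℝ S)
    (K : Subgroup (V →L[ℝ] V)ˣ)
    (hK_cpt : IsCompact (closure (K : Set (V →L[ℝ] V)ˣ)))
    (hKS : ∀ k ∈ K, ∀ x ∈ S, ((k : (V →L[ℝ] V)ˣ) : V →L[ℝ] V) x ∈ S)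
    (hS : IsOpen S ∨ IsClosed S) :
    ∃ v₀ ∈ S, ∀ k ∈ K, ((k : (V →L[ℝ] V)ˣ) : V →L[ℝ] V) v₀ = v₀ := by
  obtain ⟨v, hv⟩ := hS_ne
  have horbit := hK_cpt.image
    ((ContinuousLinearMap.apply ℝ V v).continuous.comp Units.continuous_val)
  have horbit_sub := Set.image_subset_iff.mpr fun g hg =>
    hS_conv.apply_mem_of_mem_closure_units hS hKS hg hv
  have hsub := hS.elim
    (fun hS => horbit.closure_convexHull_subset_of_isOpen hS hS_conv horbit_sub)
    (closure_minimal (convexHull_min horbit_sub hS_conv))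
  have := FiniteDimensional.complete ℝ V
  obtain ⟨v₀, hv₀, hfix⟩ :=
    K.topologicalClosure.exists_fixed_mem_of_isCompact_of_orbit_subset hK_cpt
      (convex_convexHull ℝ _).closure isClosed_closure v fun g hg =>
        subset_closure (subset_convexHull ℝ _ (Set.mem_image_of_mem _ hg))
  exact ⟨v₀, hsub hv₀, fun k hk => hfix k (K.le_topologicalClosure hk)⟩
end

section
/- Let V be a finite-dimensional real normed vector space and C ⊆ V a closed convex cone which is pointed, i.e. C ∩ (−C) = {0}. If X₀ lies in the interior of C, then the set C ∩ (X₀ − C) is compact and has nonempty interior. -/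
section

open scoped Pointwise

theorem Convex.image_const_sub {E : Type*} [AddCommGroup E] [Module ℝ E] {s : Set E}
    (hs : Convex ℝ s) (x : E) : Convex ℝ ((fun y => x - y) '' s) := by
  rw [← Set.singleton_sub]
  exact (convex_singleton x).sub hs

theorem smul_mem_interior_of_forall_smul_mem {E : Type*} [AddCommGroup E] [Module ℝ E]
    [TopologicalSpace E] [ContinuousConstSMul ℝ E] {s : Set E} {r : ℝ} (hr : r ≠ 0)
    (hs : ∀ y ∈ s, r • y ∈ s) {x : E} (hx : x ∈ interior s) : r • x ∈ interior s := by
  apply interior_mono (Set.smul_set_subset_iff.mpr fun y hy => hs y hy)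
  rw [interior_smul₀ hr]
  exact Set.smul_mem_smul_set hx

end

/-- **Order intervals in pointed closed convex cones are compact with nonempty
interior at interior points.**
Let `V` be a finite-dimensional real normed vector space and `C ⊆ V` a closed convex
cone which is pointed, i.e. `C ∩ (−C) = {0}`.  If `X₀` lies in the interior of `C`,
then `C ∩ (X₀ − C)` is compact and has nonempty interior. -/
theorem pointed_cone_inter_sub_compact
    {V : Type*} [NormedAddCommGroup V] [NormedSpace ℝ V] [FiniteDimensional ℝ V]
    (C : Set V) (hC_closed : IsClosed C) (hC_conv : Convex ℝ C)
    (hC_cone : ∀ c ∈ C, ∀ r : ℝ, 0 ≤ r → r • c ∈ C)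
    (hC_pointed : C ∩ (-C) = {0})
    (X₀ : V) (hX₀ : X₀ ∈ interior C) :
    IsCompact (C ∩ ((fun c => X₀ - c) '' C)) ∧
      (interior (C ∩ ((fun c => X₀ - c) '' C))).Nonempty := by
  have h_zero : (0 : V) ∈ C := (hC_pointed.symm.subset rfl).1
  have h_image : (fun c => X₀ - c) '' C = (Homeomorph.subLeft X₀) ⁻¹' C :=
    congrFun (Set.image_eq_preimage_of_inverse (sub_sub_cancel X₀) (sub_sub_cancel X₀)) C
  have h_closed : IsClosed (C ∩ ((fun c => X₀ - c) '' C)) := by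
    rw [h_image]
    exact hC_closed.inter (hC_closed.preimage (Homeomorph.continuous _))
  have h_conv : Convex ℝ (C ∩ ((fun c => X₀ - c) '' C)) :=
    hC_conv.inter (hC_conv.image_const_sub X₀)
  constructor
  · refine Metric.isCompact_of_isClosed_isBounded h_closed ?_
    refine isBounded_iff_asymptoticCone_subset_singleton.mpr fun v hv => ?_
    have h_translate : ∀ p ∈ C ∩ ((fun c => X₀ - c) '' C),
        v + p ∈ C ∩ ((fun c => X₀ - c) '' C) := fun p hp => by
      simpa using h_conv.smul_vadd_mem_of_isClosed_of_mem_asymptoticCone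
        h_closed zero_le_one hv hp
    have h_pos : v ∈ C := by
      simpa using (h_translate 0 ⟨h_zero, X₀, interior_subset hX₀, sub_self X₀⟩).1
    have h_neg : -v ∈ C := by
      obtain ⟨c, hc, h⟩ := (h_translate X₀ ⟨interior_subset hX₀, 0, h_zero, sub_zero X₀⟩).2
      have : c = -v := by
        rw [← sub_sub_cancel X₀ c, show X₀ - c = v + X₀ from h]
        abel
      exact this ▸ hc
    exact hC_pointed.subset ⟨h_pos, h_neg⟩
  · have h_half : (2⁻¹ : ℝ) • X₀ ∈ interior C :=
      smul_mem_interior_of_forall_smul_mem (by norm_num)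
        (fun c hc => hC_cone c hc _ (by norm_num)) hX₀
    refine ⟨(2⁻¹ : ℝ) • X₀, ?_⟩
    rw [h_image, interior_inter, ← Homeomorph.preimage_interior]
    refine ⟨h_half, ?_⟩
    have h_sub : X₀ - (2⁻¹ : ℝ) • X₀ = (2⁻¹ : ℝ) • X₀ := by module
    simpa [h_sub] using h_half
end

section
/- Let V be a finite-dimensional real normed vector space, K a subgroup of GL(V), and S ⊆ V a compact set with nonempty interior such that k(S) ⊆ S for every k ∈ K. Then the closure of K in GL(V) is compact. -/
/-- A continuous linear map sending a closed ball of radius `r` into the closed ball of radius `M`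
around the origin has operator norm at most `2 * M / r`. -/
lemma ContinuousLinearMap.opNorm_le_of_mapsTo_closedBall {E F : Type*} [NormedAddCommGroup E]
    [NormedSpace ℝ E] [NormedAddCommGroup F] [NormedSpace ℝ F] (f : E →L[ℝ] F) {x₀ : E}
    {r M : ℝ} (hr : 0 < r)
    (hf : Set.MapsTo f (Metric.closedBall x₀ r) (Metric.closedBall 0 M)) :
    ‖f‖ ≤ 2 * M / r := by
  have hx₀ : ‖f x₀‖ ≤ M := by simpa using hf (Metric.mem_closedBall_self hr.le)
  have hM : 0 ≤ M := (norm_nonneg _).trans hx₀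
  refine f.opNorm_le_bound (by positivity) fun x => ?_
  rcases eq_or_ne x 0 with rfl | hx
  · simp
  have hx' : 0 < ‖x‖ := norm_pos_iff.2 hx
  have hmem : x₀ + (r / ‖x‖) • x ∈ Metric.closedBall x₀ r := by
    rw [Metric.mem_closedBall, dist_self_add_left, norm_smul, Real.norm_of_nonneg (by positivity),
      div_mul_cancel₀ _ hx'.ne']
  have hadd : ‖f (x₀ + (r / ‖x‖) • x)‖ ≤ M := by simpa using hf hmem
  have hsmul : r / ‖x‖ * ‖f x‖ ≤ 2 * M :=
    calc r / ‖x‖ * ‖f x‖ = ‖f (x₀ + (r / ‖x‖) • x) - f x₀‖ := by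
          rw [map_add, add_sub_cancel_left, map_smul, norm_smul,
            Real.norm_of_nonneg (by positivity)]
      _ ≤ 2 * M := by linarith [norm_sub_le (f (x₀ + (r / ‖x‖) • x)) (f x₀)]
  rw [div_mul_eq_mul_div, div_le_iff₀ hx'] at hsmul
  rw [div_mul_eq_mul_div, le_div_iff₀ hr]
  linarith

/-- In a proper normed ring, the units bounded by `C` together with their inverses form a compact
set. -/
lemma Units.isCompact_setOf_norm_le {R : Type*} [NormedRing R] [ProperSpace R] (C : ℝ) :
    IsCompact {u : Rˣ | ‖(u : R)‖ ≤ C ∧ ‖((u⁻¹ : Rˣ) : R)‖ ≤ C} := by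
  have hball := isCompact_closedBall (0 : R) C
  convert Units.isClosedEmbedding_embedProduct.isCompact_preimage
    (hball.prod (hball.image MulOpposite.continuous_op)) using 1
  ext u
  simp [Units.embedProduct]

/-- **A linear group preserving a compact set with nonempty interior has compact
closure.**
Let `V` be a finite-dimensional real normed vector space, `K` a subgroup of `GL(V)`,
and `S ⊆ V` a compact set with nonempty interior such that `k(S) ⊆ S` for every
`k ∈ K`.  Then the closure of `K` in `GL(V)` is compact. -/
theorem subgroup_preserving_compact_set_has_compact_closure
    {V : Type*} [NormedAddCommGroup V] [NormedSpace ℝ V] [FiniteDimensional ℝ V]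
    (K : Subgroup (V →L[ℝ] V)ˣ)
    (S : Set V) (hS_cpt : IsCompact S) (hS_int : (interior S).Nonempty)
    (hKS : ∀ k ∈ K, ∀ x ∈ S, ((k : (V →L[ℝ] V)ˣ) : V →L[ℝ] V) x ∈ S) :
    IsCompact (closure (K : Set (V →L[ℝ] V)ˣ)) := by
  have : ProperSpace (V →L[ℝ] V) := FiniteDimensional.proper ℝ _
  obtain ⟨x₀, hx₀⟩ := hS_int
  obtain ⟨r, hr, hrS⟩ := Metric.nhds_basis_closedBall.mem_iff.1 (mem_interior_iff_mem_nhds.1 hx₀)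
  obtain ⟨M, hM⟩ := hS_cpt.isBounded.subset_closedBall 0
  have hbound : ∀ k ∈ K, ‖(k : V →L[ℝ] V)‖ ≤ 2 * M / r := fun k hk =>
    ContinuousLinearMap.opNorm_le_of_mapsTo_closedBall _ hr
      fun x hx => hM (hKS k hk x (hrS hx))
  exact (Units.isCompact_setOf_norm_le (2 * M / r)).closure_of_subset
    fun k hk => ⟨hbound k hk, hbound k⁻¹ (K.inv_mem hk)⟩
end
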